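/- There do not exist integers a, b, c with a and c even such that the 4×4 matrix [[a, b, 1, 0], [b, c, 0, 1], [1, 0, 2, 0], [0, 1, 0, 2]] is positive definite and has determinant equal to 1 or to 25. Equivalently, there is no positive definite even symmetric 4×4 integer matrix of half-integer surgery type with determinant 1 or 25. -/

import Mathlib

theorem Nat.exists_prime_dvd_mod_four_eq_three {n : ℕ} (hn : n % 4 = 3) :
    ∃ p, p.Prime ∧ p ∣ n ∧ p % 4 = 3 := by
  induction n using Nat.recOnMul with
  | zero => omega
  | one => omega
  | prime p hp => exact ⟨p, hp, dvd_rfl, hn⟩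
  | mul a b iha ihb =>
    have h : a % 4 = 3 ∨ b % 4 = 3 := by
      have ha : a % 4 < 4 := Nat.mod_lt _ (by norm_num)
      have hb : b % 4 < 4 := Nat.mod_lt _ (by norm_num)
      rw [Nat.mul_mod] at hn
      generalize a % 4 = r at *
      generalize b % 4 = s at *
      interval_cases r <;> interval_cases s <;> simp_all
    obtain h | h := h
    · obtain ⟨p, hp, hd, h3⟩ := iha h
      exact ⟨p, hp, hd.mul_right b, h3⟩
    · obtain ⟨p, hp, hd, h3⟩ := ihb h
      exact ⟨p, hp, hd.mul_left a, h3⟩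

theorem Int.not_dvd_sq_add_five_pow_of_emod_four_eq_three {m : ℤ} (hm : 0 < m)
    (h3 : m % 4 = 3) (x : ℤ) (k : ℕ) : ¬ m ∣ x ^ 2 + (5 ^ k) ^ 2 := by
  intro h
  lift m to ℕ using hm.le
  obtain ⟨p, hp, hpm, hp3⟩ := Nat.exists_prime_dvd_mod_four_eq_three (n := m) (by omega)
  have : Fact p.Prime := ⟨hp⟩
  have hd : (p : ℤ) ∣ x ^ 2 + (5 ^ k) ^ 2 := (Int.natCast_dvd_natCast.mpr hpm).trans h
  rw [← ZMod.intCast_zmod_eq_zero_iff_dvd] at hd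
  push_cast at hd
  have h5 : (5 : ZMod p) ≠ 0 := by
    intro h5
    have h5' : p ∣ 5 := (ZMod.natCast_eq_zero_iff 5 p).mp (by exact_mod_cast h5)
    rw [Nat.prime_dvd_prime_iff_eq hp (by norm_num)] at h5'
    omega
  exact ZMod.mod_four_ne_three_of_sq_eq_neg_sq' (pow_ne_zero k h5)
    (eq_neg_of_add_eq_zero_left hd) hp3

/-- There is no positive definite even symmetric `4 × 4` integer matrix of half-integer
surgery type with determinant `1` or `25`:  there are no integers `a, b, c` with `a` and `c`
even such that `[[a, b, 1, 0], [b, c, 0, 1], [1, 0, 2, 0], [0, 1, 0, 2]]` is positive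
definite with determinant `1` or `25`. -/
theorem no_even_halfIntegerSurgeryType_det_one_or_25 :
    ¬ ∃ a b c : ℤ, Even a ∧ Even c ∧
      (∀ x : Fin 4 → ℤ, x ≠ 0 →
        0 < x ⬝ᵥ ((!![a, b, 1, 0; b, c, 0, 1; 1, 0, 2, 0; 0, 1, 0, 2]).mulVec x)) ∧
      ((!![a, b, 1, 0; b, c, 0, 1; 1, 0, 2, 0; 0, 1, 0, 2] : Matrix (Fin 4) (Fin 4) ℤ).det = 1 ∨
       (!![a, b, 1, 0; b, c, 0, 1; 1, 0, 2, 0; 0, 1, 0, 2] : Matrix (Fin 4) (Fin 4) ℤ).det = 25) := by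
  rintro ⟨a, b, c, ⟨k, rfl⟩, ⟨l, rfl⟩, hpos, hdet⟩
  have ha := hpos ![2, 0, -1, 0] (fun h ↦ by simpa using congrFun h 0)
  simp [Matrix.mulVec, dotProduct, Fin.sum_univ_four] at ha
  have hd : (!![k + k, b, 1, 0; b, l + l, 0, 1; 1, 0, 2, 0; 0, 1, 0, 2] :
      Matrix (Fin 4) (Fin 4) ℤ).det = (4 * k - 1) * (4 * l - 1) - (2 * b) ^ 2 := by
    simp [Matrix.det_succ_row_zero, Fin.sum_univ_succ, Fin.succAbove]
    ring
  rw [hd] at hdet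
  have hdvd := Int.not_dvd_sq_add_five_pow_of_emod_four_eq_three (m := 4 * k - 1)
    (by omega) (by omega) (2 * b)
  obtain h | h := hdet
  · exact hdvd 0 ⟨4 * l - 1, by linarith⟩
  · exact hdvd 1 ⟨4 * l - 1, by linarith⟩
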